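/- Let F be any field and V = F^ω the space of all F-valued sequences. For i ∈ ω let V_i = {(v_j)_{j∈ω} : v_j = 0 for all j < i}. Then 𝓛 = {V_i : i ∈ ω} ∪ {0} is a series in V, every jump of 𝓛 has 1-dimensional quotient, and V admits no 𝓛-adapted basis (indeed no basis 𝓑 such that for each jump (B,T), {v+B : v ∈ 𝓑 ∩ (T\B)} is a basis of T/B, because 𝓛 has only countably many jumps each of dimension 1 while V has uncountable dimension). -/

import Mathlib

section Defs

variable {F V : Type*} [Field F] [AddCommGroup V] [Module F V]

/-- A *series* in a vector space `V`. -/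
def IsSeries (𝓛 : Set (Submodule F V)) : Prop :=
  ⊥ ∈ 𝓛 ∧ ⊤ ∈ 𝓛 ∧ IsChain (· ≤ ·) 𝓛 ∧
    ∀ 𝓕 : Set (Submodule F V), 𝓕 ⊆ 𝓛 → 𝓕.Nonempty → sInf 𝓕 ∈ 𝓛 ∧ sSup 𝓕 ∈ 𝓛

/-- `(B, T)` is a *jump* of the series `𝓛`. -/
def IsJump (𝓛 : Set (Submodule F V)) (B T : Submodule F V) : Prop :=
  B ∈ 𝓛 ∧ T ∈ 𝓛 ∧ B < T ∧ ∀ U ∈ 𝓛, B ≤ U → U ≤ T → U = B ∨ U = T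

end Defs

/-- The subspace `V_i = {(v_j) : v_j = 0 for all j < i}` of `V = F^ω`. -/
noncomputable def Vseq (F : Type*) [Field F] (i : ℕ) : Submodule F (ℕ → F) :=
  ⨅ j ∈ Set.Iio i, LinearMap.ker (LinearMap.proj (R := F) (φ := fun _ : ℕ => F) j)

theorem mem_Vseq {F : Type*} [Field F] {i : ℕ} {v : ℕ → F} :
    v ∈ Vseq F i ↔ ∀ j < i, v j = 0 := by
  simp [Vseq, Submodule.mem_iInf]

theorem Vseq_le_iff {F : Type*} [Field F] {i j : ℕ} : Vseq F i ≤ Vseq F j ↔ j ≤ i := by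
  constructor
  · intro h
    by_contra hc
    have h1 : (Pi.single i 1 : ℕ → F) ∈ Vseq F i := by
      rw [mem_Vseq]
      intro k hk
      rw [Pi.single_eq_of_ne (by omega)]
    have h2 := mem_Vseq.1 (h h1) i (by omega)
    simp at h2
  · intro h v hv
    rw [mem_Vseq] at *
    intro k hk
    exact hv k (by omega)

theorem Vseq_ne_bot {F : Type*} [Field F] (i : ℕ) : Vseq F i ≠ ⊥ := by
  intro h
  have h1 : Vseq F i ≤ Vseq F (i + 1) := by rw [h]; exact bot_le
  rw [Vseq_le_iff] at h1
  omega

theorem Vseq_inj {F : Type*} [Field F] {i j : ℕ} (h : Vseq F i = Vseq F j) : i = j :=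
  le_antisymm (Vseq_le_iff.1 h.ge) (Vseq_le_iff.1 h.le)

theorem Vseq_isJump_iff {F : Type*} [Field F] {B T : Submodule F (ℕ → F)} :
    IsJump (Set.range (Vseq F) ∪ {⊥}) B T ↔ ∃ i, B = Vseq F (i + 1) ∧ T = Vseq F i := by
  constructor
  · rintro ⟨hB, hT, hlt, hU⟩
    rcases hT with ⟨i, rfl⟩ | hT
    · refine ⟨i, ?_, rfl⟩
      have key : B ≤ Vseq F (i + 1) := by
        rcases hB with ⟨j, rfl⟩ | hB
        · rw [Vseq_le_iff]
          have h1 := Vseq_le_iff.1 hlt.le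
          have h2 : i ≠ j := by rintro rfl; exact lt_irrefl _ hlt
          omega
        · rw [Set.mem_singleton_iff] at hB
          rw [hB]; exact bot_le
      rcases hU _ (Or.inl ⟨i + 1, rfl⟩) key (Vseq_le_iff.2 (by omega)) with h | h
      · exact h.symm
      · have := Vseq_inj h
        omega
    · rw [Set.mem_singleton_iff] at hT
      subst hT
      exact absurd hlt not_lt_bot
  · rintro ⟨i, rfl, rfl⟩
    refine ⟨Or.inl ⟨_, rfl⟩, Or.inl ⟨_, rfl⟩, ?_, ?_⟩
    · rw [lt_iff_le_not_ge, Vseq_le_iff, Vseq_le_iff]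
      omega
    · rintro U (⟨j, rfl⟩ | hU) h1 h2
      · rw [Vseq_le_iff] at h1 h2
        have : j = i + 1 ∨ j = i := by omega
        rcases this with rfl | rfl <;> simp
      · rw [Set.mem_singleton_iff] at hU
        subst hU
        exact absurd (le_bot_iff.1 h1) (Vseq_ne_bot _)

theorem Vseq_isSeries (F : Type*) [Field F] : IsSeries (Set.range (Vseq F) ∪ {⊥}) := by
  refine ⟨Or.inr rfl, Or.inl ⟨0, ?_⟩, ?_, ?_⟩
  · rw [eq_top_iff]
    intro v _
    rw [mem_Vseq]
    intro j hj
    omega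
  · rintro U hU W hW -
    rcases hU with ⟨i, rfl⟩ | hU
    · rcases hW with ⟨j, rfl⟩ | hW
      · simp only [Vseq_le_iff]
        omega
      · rw [Set.mem_singleton_iff] at hW
        subst hW
        exact Or.inr bot_le
    · rw [Set.mem_singleton_iff] at hU
      subst hU
      exact Or.inl bot_le
  · intro 𝓕 hF hne
    constructor
    · by_cases hb : ⊥ ∈ 𝓕
      · exact Or.inr (le_bot_iff.1 (sInf_le hb))
      · have hr : ∀ U ∈ 𝓕, ∃ i, Vseq F i = U := by
          intro U hU
          rcases hF hU with h | h
          · exact h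
          · rw [Set.mem_singleton_iff] at h
            subst h
            exact absurd hU hb
        by_cases hbd : BddAbove {i | Vseq F i ∈ 𝓕}
        · have hne' : {i | Vseq F i ∈ 𝓕}.Nonempty := by
            obtain ⟨U, hU⟩ := hne
            obtain ⟨i, rfl⟩ := hr U hU
            exact ⟨i, hU⟩
          have hm := Nat.sSup_mem hne' hbd
          refine Or.inl ⟨sSup {i | Vseq F i ∈ 𝓕}, le_antisymm (le_sInf ?_) (sInf_le hm)⟩
          intro U hU
          obtain ⟨i, rfl⟩ := hr U hU
          rw [Vseq_le_iff]
          exact le_csSup hbd hU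
        · refine Or.inr ?_
          rw [Set.mem_singleton_iff, eq_bot_iff]
          intro v hv
          rw [Submodule.mem_bot]
          funext k
          rw [not_bddAbove_iff] at hbd
          obtain ⟨i, hi, hki⟩ := hbd k
          exact mem_Vseq.1 ((Submodule.mem_sInf.1 hv) _ hi) k hki
    · by_cases hex : ∃ i, Vseq F i ∈ 𝓕
      · classical
        refine Or.inl ⟨Nat.find hex, le_antisymm (le_sSup (Nat.find_spec hex)) (sSup_le ?_)⟩
        intro U hU
        rcases hF hU with ⟨i, rfl⟩ | h
        · rw [Vseq_le_iff]
          exact Nat.find_min' hex hU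
        · rw [Set.mem_singleton_iff] at h
          subst h
          exact bot_le
      · refine Or.inr ?_
        rw [Set.mem_singleton_iff, eq_bot_iff]
        refine sSup_le ?_
        intro U hU
        rcases hF hU with ⟨i, rfl⟩ | h
        · exact absurd ⟨i, hU⟩ hex
        · exact (Set.mem_singleton_iff.1 h).le

theorem Vseq_mkQ_smul {F : Type*} [Field F] {i : ℕ} {x y : ℕ → F} (hx : x ∈ Vseq F i)
    (hy : y ∈ Vseq F i) :
    y i • (Vseq F (i + 1)).mkQ x = x i • (Vseq F (i + 1)).mkQ y := by
  rw [← map_smul, ← map_smul, ← sub_eq_zero, ← map_sub, Submodule.mkQ_apply,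
    Submodule.Quotient.mk_eq_zero, mem_Vseq]
  intro j hj
  rcases Nat.lt_succ_iff_lt_or_eq.1 hj with h | rfl
  · simp [mem_Vseq.1 hx j h, mem_Vseq.1 hy j h]
  · simp [mul_comm]

theorem Vseq_rank {F : Type*} [Field F] (i : ℕ) :
    Module.rank F ↥((Vseq F i).map (Vseq F (i + 1)).mkQ) = 1 := by
  have h1 : (Pi.single i 1 : ℕ → F) ∈ Vseq F i := by
    rw [mem_Vseq]
    intro k hk
    rw [Pi.single_eq_of_ne (by omega)]
  refine rank_eq_one
    (⟨(Vseq F (i + 1)).mkQ (Pi.single i 1), Submodule.mem_map_of_mem h1⟩ :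
      ↥((Vseq F i).map (Vseq F (i + 1)).mkQ)) ?_ ?_
  · intro h
    have h2 := congrArg Subtype.val h
    simp only [Submodule.mkQ_apply, Submodule.coe_zero] at h2
    rw [Submodule.Quotient.mk_eq_zero, mem_Vseq] at h2
    have := h2 i (by omega)
    simp at this
  · rintro ⟨w, y, hy, rfl⟩
    refine ⟨y i, Subtype.ext ?_⟩
    have := Vseq_mkQ_smul h1 hy
    simpa using this

theorem Vseq_first {F : Type*} [Field F] {v : ℕ → F} (hv : v ≠ 0) :
    ∃ i, v ∈ Vseq F i ∧ v i ≠ 0 := by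
  classical
  have h : ∃ i, v i ≠ 0 := Function.ne_iff.1 hv
  refine ⟨Nat.find h, ?_, Nat.find_spec h⟩
  rw [mem_Vseq]
  intro j hj
  exact not_not.1 (Nat.find_min h hj)

/-- For `V = F^ω` and `V_i = {(v_j) : v_j = 0 ∀ j < i}`, the set
`𝓛 = {V_i : i ∈ ω} ∪ {0}` is a series in `V`, every jump of `𝓛` has one-dimensional
quotient, yet `V` has no `𝓛`-adapted basis. -/
theorem stmt11 (F : Type*) [Field F] :
    IsSeries (Set.range (Vseq F) ∪ {⊥}) ∧
    (∀ B T : Submodule F (ℕ → F), IsJump (Set.range (Vseq F) ∪ {⊥}) B T →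
      Module.rank F ↥(T.map B.mkQ) = 1) ∧
    ¬ ∃ ℬ : Set (ℕ → F),
        LinearIndependent F (fun v : ℬ => (v : ℕ → F)) ∧
        Submodule.span F ℬ = ⊤ ∧
        ∀ B T : Submodule F (ℕ → F), IsJump (Set.range (Vseq F) ∪ {⊥}) B T →
          (LinearIndependent F
            (fun x : ↥(ℬ ∩ ((T : Set (ℕ → F)) \ (B : Set (ℕ → F)))) =>
              B.mkQ (x : ℕ → F)) ∧
          Submodule.span F (B.mkQ '' (ℬ ∩ ((T : Set (ℕ → F)) \ (B : Set (ℕ → F)))))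
            = T.map B.mkQ) := by
  refine ⟨Vseq_isSeries F, ?_, ?_⟩
  · intro B T h
    obtain ⟨i, rfl, rfl⟩ := Vseq_isJump_iff.1 h
    exact Vseq_rank i
  · rintro ⟨ℬ, hli, hsp, hJ⟩
    have hf : ∀ v : ℬ, ∃ i, (v : ℕ → F) ∈ Vseq F i ∧ (v : ℕ → F) i ≠ 0 :=
      fun v => Vseq_first (hli.ne_zero v)
    choose f hf1 hf2 using hf
    have hinj : Function.Injective f := by
      intro x y hxy
      by_contra hne
      obtain ⟨hl, -⟩ := hJ _ _ (Vseq_isJump_iff.2 ⟨f x, rfl, rfl⟩)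
      have hx2 : (x : ℕ → F) ∉ Vseq F (f x + 1) := fun h =>
        hf2 x (mem_Vseq.1 h _ (Nat.lt_succ_self _))
      have hy1 : (y : ℕ → F) ∈ Vseq F (f x) := hxy ▸ hf1 y
      have hy2' : (y : ℕ → F) (f x) ≠ 0 := hxy ▸ hf2 y
      have hy2 : (y : ℕ → F) ∉ Vseq F (f x + 1) := fun h =>
        hy2' (mem_Vseq.1 h _ (Nat.lt_succ_self _))
      let a : ↥(ℬ ∩ ((Vseq F (f x) : Set (ℕ → F)) \ (Vseq F (f x + 1) : Set (ℕ → F)))) :=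
        ⟨x, x.2, hf1 x, hx2⟩
      let b : ↥(ℬ ∩ ((Vseq F (f x) : Set (ℕ → F)) \ (Vseq F (f x + 1) : Set (ℕ → F)))) :=
        ⟨y, y.2, hy1, hy2⟩
      have hab : a ≠ b := fun h => by
        have h0 : a.1 = b.1 := by rw [h]
        exact hne (Subtype.ext h0)
      have hpair : LinearIndependent F
          ![(Vseq F (f x + 1)).mkQ (x : ℕ → F), (Vseq F (f x + 1)).mkQ (y : ℕ → F)] := by
        have hi : Function.Injective ![a, b] := by
          intro m n hmn
          fin_cases m <;> fin_cases n <;> simp_all [hab.symm]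
        convert hl.comp ![a, b] hi using 1
        funext m
        fin_cases m <;> rfl
      have hp := hpair.eq_zero_of_pair' (Vseq_mkQ_smul (hf1 x) hy1)
      exact hy2' hp.1
    have hc : ℬ.Countable := hinj.countable
    have h1 : Module.rank F (ℕ → F) ≤ Cardinal.aleph0 := by
      rw [← rank_top, ← hsp]
      exact (rank_span_le ℬ).trans hc.le_aleph0
    rw [rank_fun_infinite] at h1
    have h2 : Countable (ℕ → F) := Cardinal.mk_le_aleph0_iff.1 h1
    have h3 : Function.Injective (fun (s : Set ℕ) (n : ℕ) => s.indicator (1 : ℕ → F) n) := by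
      intro s t hst
      ext n
      have := congrFun hst n
      by_cases hs : n ∈ s <;> by_cases ht : n ∈ t <;> simp_all
    have h4 : Countable (Set ℕ) := h3.countable
    have h5 := Cardinal.mk_le_aleph0_iff.2 h4
    rw [Cardinal.mk_set, Cardinal.mk_nat] at h5
    exact absurd h5 (not_le.2 (Cardinal.cantor _))
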